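/- Let C be an optimal LRC with locality r of length n over a finite field F with q = |F|, with dimension k ≥ 1 and minimum distance d ≥ 5, where (r+1) ∣ n and n/(r+1) ≥ (d - 2 - ⌊(d-2)/(r+1)⌋)·(3r+2) + ⌊(d-2)/(r+1)⌋ + 1. Let a ∈ {3,4} be such that d ≡ a (mod 4). Then, as real numbers, n ≤ ((r+1)/r) · ( ((d-a)/(4(q-1))) · q^(4(d-3)/(d-a)) + 1 ), where the exponent 4(d-3)/(d-a) is a real number. -/

import Mathlib

/-- The dual code of a linear code `C ⊆ F^n`. -/
def dualCode {F : Type*} [Field F] {n : ℕ} (C : Submodule F (Fin n → F)) :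
    Set (Fin n → F) :=
  {v | ∀ c ∈ C, ∑ i, v i * c i = 0}

/-- `C` has locality `r`: every coordinate `i` has a dual codeword `v` with `v i ≠ 0`
whose support has size at most `r + 1`. -/
def HasLocality {F : Type*} [Field F] [DecidableEq F] {n : ℕ}
    (C : Submodule F (Fin n → F)) (r : ℕ) : Prop :=
  ∀ i : Fin n, ∃ v ∈ dualCode C, v i ≠ 0 ∧ hammingNorm v ≤ r + 1

/-- `d` is the minimum Hamming distance (= least weight of a nonzero codeword) of `C`. -/
def IsMinDist {F : Type*} [Field F] [DecidableEq F] {n : ℕ}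
    (C : Submodule F (Fin n → F)) (d : ℕ) : Prop :=
  IsLeast {w : ℕ | ∃ c ∈ C, c ≠ 0 ∧ hammingNorm c = w} d

/-- A family of sets of size at most `R` whose union falls short of the maximal possible size by at
least `m` has a subfamily with at most `2 * m` members and the same shortfall. -/
theorem exists_small_subfamily {ι α : Type*} [DecidableEq ι] [DecidableEq α] (S : ι → Finset α)
    (R : ℕ) (hS : ∀ i, (S i).card ≤ R) (A : Finset ι) (m : ℕ)
    (hA : m + (A.biUnion S).card ≤ R * A.card) :
    ∃ W ⊆ A, W.card ≤ 2 * m ∧ m + (W.biUnion S).card ≤ R * W.card := by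
  induction m with
  | zero => exact ⟨∅, by simp, by simp, by simp⟩
  | succ m ih =>
    obtain ⟨W, hWA, hWc, hW⟩ := ih (by omega)
    by_contra! hcon
    have insert_one : ∀ i ∈ A, i ∉ W → (S i).card = R ∧ Disjoint (S i) (W.biUnion S) := by
      intro i hi hiW
      have h := hcon (insert i W) (Finset.insert_subset hi hWA)
        (by rw [Finset.card_insert_of_notMem hiW]; omega)
      rw [Finset.biUnion_insert, Finset.card_insert_of_notMem hiW] at h
      have h1 := Finset.card_union_add_card_inter (S i) (W.biUnion S)
      have h2 := hS i
      rw [mul_add, mul_one] at h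
      refine ⟨by omega, ?_⟩
      rw [Finset.disjoint_iff_inter_eq_empty, ← Finset.card_eq_zero]
      omega
    have insert_two : ∀ i ∈ A, i ∉ W → ∀ j ∈ A, j ∉ W → i ≠ j → Disjoint (S i) (S j) := by
      intro i hi hiW j hj hjW hij
      have hj' : j ∉ insert i W := by simp [hjW, hij.symm]
      have h := hcon (insert j (insert i W))
        (Finset.insert_subset hj (Finset.insert_subset hi hWA))
        (by rw [Finset.card_insert_of_notMem hj', Finset.card_insert_of_notMem hiW]; omega)
      rw [Finset.biUnion_insert, Finset.biUnion_insert, Finset.card_insert_of_notMem hj',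
        Finset.card_insert_of_notMem hiW] at h
      have h1 := Finset.card_union_add_card_inter (S i) (W.biUnion S)
      have h2 := Finset.card_union_add_card_inter (S j) (S i ∪ W.biUnion S)
      have h3 := hS i
      have h4 := hS j
      have h5 : (S i ∩ S j).card ≤ (S j ∩ (S i ∪ W.biUnion S)).card := by
        apply Finset.card_le_card
        intro x
        simp only [Finset.mem_inter, Finset.mem_union]
        tauto
      rw [mul_add, mul_add, mul_one] at h
      rw [Finset.disjoint_iff_inter_eq_empty, ← Finset.card_eq_zero]
      omega
    have hlt := hcon W hWA (by omega)
    have hsplit : A.biUnion S = W.biUnion S ∪ (A \ W).biUnion S := by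
      rw [← Finset.union_biUnion, Finset.union_sdiff_of_subset hWA]
    have hdisj : Disjoint (W.biUnion S) ((A \ W).biUnion S) := by
      rw [Finset.disjoint_biUnion_right]
      intro i hi
      rw [Finset.mem_sdiff] at hi
      exact (insert_one i hi.1 hi.2).2.symm
    have hcard : ((A \ W).biUnion S).card = R * (A \ W).card := by
      rw [Finset.card_biUnion, Finset.sum_const_nat (m := R), mul_comm]
      · intro i hi
        rw [Finset.mem_sdiff] at hi
        exact (insert_one i hi.1 hi.2).1
      · intro i hi j hj hij
        rw [Finset.mem_coe, Finset.mem_sdiff] at hi hj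
        exact insert_two i hi.1 hi.2 j hj.1 hj.2 hij
    rw [hsplit, Finset.card_union_of_disjoint hdisj, hcard] at hA
    have h6 := Finset.card_sdiff_add_card_eq_card hWA
    rw [← h6, mul_add] at hA
    omega

/-- A set `U` of more than `n - d` coordinates that contains the supports of dual words `v i`, each
with a private coordinate `p i`, has at least `k + |A|` elements: a codeword vanishing on `U` outside
the private coordinates vanishes on all of `U`. -/
theorem finrank_add_card_le {F : Type*} [Field F] [DecidableEq F] {n d : ℕ}
    (C : Submodule F (Fin n → F)) (hd : ∀ c ∈ C, c ≠ 0 → d ≤ hammingNorm c)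
    {ι : Type*} [DecidableEq ι] (v : ι → Fin n → F) (hv : ∀ i, v i ∈ dualCode C) (A : Finset ι)
    (p : ι → Fin n) (hp : ∀ i ∈ A, v i (p i) ≠ 0)
    (hpriv : ∀ i ∈ A, ∀ j ∈ A, i ≠ j → v j (p i) = 0)
    (U : Finset (Fin n)) (hU : ∀ i ∈ A, ∀ x, v i x ≠ 0 → x ∈ U) (hUd : n < U.card + d) :
    Module.finrank F C + A.card ≤ U.card := by
  have hinj : Set.InjOn p A := by
    intro i hi j hj hij
    by_contra hne
    exact hp i hi (by rw [hij]; exact hpriv j hj i hi (Ne.symm hne))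
  have hsub : A.image p ⊆ U := by
    intro x hx
    obtain ⟨i, hi, rfl⟩ := Finset.mem_image.1 hx
    exact hU i hi _ (hp i hi)
  let φ : C →ₗ[F] (↥(U \ A.image p) → F) :=
    (LinearMap.funLeft F F (fun x : ↥(U \ A.image p) => (x : Fin n))).comp C.subtype
  have hφ : Function.Injective φ := by
    rw [← LinearMap.ker_eq_bot, LinearMap.ker_eq_bot']
    intro c hc
    have h0 : ∀ x ∈ U, x ∉ A.image p → (c : Fin n → F) x = 0 := by
      intro x hx hxp
      exact congrFun hc ⟨x, Finset.mem_sdiff.2 ⟨hx, hxp⟩⟩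
    have h1 : ∀ x ∈ U, (c : Fin n → F) x = 0 := by
      intro x hx
      by_cases hxp : x ∈ A.image p
      · obtain ⟨i, hi, rfl⟩ := Finset.mem_image.1 hxp
        have hsum := hv i c c.2
        rw [Finset.sum_eq_single (p i)] at hsum
        · exact (mul_eq_zero.1 hsum).resolve_left (hp i hi)
        · intro y _ hy
          by_cases hvy : v i y = 0
          · simp [hvy]
          · by_cases hyp : y ∈ A.image p
            · obtain ⟨j, hj, rfl⟩ := Finset.mem_image.1 hyp
              exact absurd (hpriv j hj i hi (fun h => hy (by rw [h]))) hvy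
            · rw [h0 y (hU i hi y hvy) hyp, mul_zero]
        · simp
      · exact h0 x hx hxp
    by_contra hne
    have h2 := hd c c.2 (fun h => hne (Subtype.ext h))
    have h3 : hammingNorm (c : Fin n → F) ≤ (Uᶜ).card := by
      apply Finset.card_le_card
      intro x hx
      simp only [Finset.mem_filter, Finset.mem_univ, true_and] at hx
      rw [Finset.mem_compl]
      exact fun h => hx (h1 x h)
    rw [Finset.card_compl, Fintype.card_fin] at h3
    have h4 := Finset.card_le_univ U
    rw [Fintype.card_fin] at h4
    omega
  have h5 := LinearMap.finrank_le_finrank_of_injective hφ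
  rw [Module.finrank_fintype_fun_eq_card, Fintype.card_coe] at h5
  have h6 := Finset.card_sdiff_add_card_eq_card hsub
  rw [Finset.card_image_of_injOn hinj] at h6
  omega

/-- A lower bound for the number of vectors of weight `e`. -/
theorem choose_mul_pow_le_card_sphere {F : Type*} [Field F] [Fintype F] [DecidableEq F]
    {J : Type*} [Fintype J] [DecidableEq J] (e : ℕ) :
    (Fintype.card J).choose e * (Fintype.card F - 1) ^ e ≤
      (Finset.univ.filter fun b : J → F => hammingNorm b = e).card := by
  let B : Finset J → Finset (J → F) := fun S =>
    Fintype.piFinset fun j => if j ∈ S then Finset.univ.erase 0 else {0}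
  have hB : ∀ S, ∀ b ∈ B S, (Finset.univ.filter fun j => b j ≠ 0) = S := by
    intro S b hb
    ext j
    have h := Fintype.mem_piFinset.1 hb j
    by_cases hj : j ∈ S <;> simp_all
  have hcard : ∀ S ∈ (Finset.univ : Finset J).powersetCard e,
      (B S).card = (Fintype.card F - 1) ^ e := by
    intro S hS
    rw [Fintype.card_piFinset]
    simp only [apply_ite Finset.card, Finset.card_singleton,
      Finset.card_erase_of_mem (Finset.mem_univ (0 : F)), Finset.card_univ]
    rw [Finset.prod_ite, Finset.prod_const_one, mul_one, Finset.prod_const,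
      Finset.filter_mem_eq_inter, Finset.univ_inter, (Finset.mem_powersetCard.1 hS).2]
  have hunion : (((Finset.univ : Finset J).powersetCard e).biUnion B).card =
      (Fintype.card J).choose e * (Fintype.card F - 1) ^ e := by
    rw [Finset.card_biUnion, Finset.sum_const_nat hcard, Finset.card_powersetCard,
      Finset.card_univ]
    intro S _ T _ hST
    rw [Function.onFun, Finset.disjoint_left]
    intro b hbS hbT
    exact hST ((hB S b hbS).symm.trans (hB T b hbT))
  rw [← hunion]
  apply Finset.card_le_card
  intro b hb
  obtain ⟨S, hS, hbS⟩ := Finset.mem_biUnion.1 hb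
  rw [Finset.mem_filter]
  refine ⟨Finset.mem_univ _, ?_⟩
  rw [hammingNorm, hB S b hbS]
  exact (Finset.mem_powersetCard.1 hS).2

/-- The sphere-packing bound for the restriction of a code to the coordinates in `J`. -/
theorem pow_finrank_mul_choose_le {F : Type*} [Field F] [Fintype F] [DecidableEq F] {n e : ℕ}
    (C : Submodule F (Fin n → F)) (J : Finset (Fin n))
    (hJ : ∀ c ∈ C, c ≠ 0 → 2 * e < (J.filter fun x => c x ≠ 0).card) :
    Fintype.card F ^ Module.finrank F C * (J.card.choose e * (Fintype.card F - 1) ^ e) ≤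
      Fintype.card F ^ J.card := by
  classical
  have h1 := choose_mul_pow_le_card_sphere (F := F) (J := J) e
  rw [Fintype.card_coe] at h1
  let φ : C →ₗ[F] (J → F) := (LinearMap.funLeft F F (fun x : J => (x : Fin n))).comp C.subtype
  have hφ : ∀ c : C, c ≠ 0 → 2 * e < hammingNorm (φ c) := by
    intro c hc
    refine (hJ c c.2 (fun h => hc (Subtype.ext h))).trans_le ?_
    rw [hammingNorm, ← Finset.card_map (Function.Embedding.subtype _)]
    apply Finset.card_le_card
    intro x hx
    rw [Finset.mem_filter] at hx
    rw [Finset.mem_map]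
    exact ⟨⟨x, hx.1⟩, Finset.mem_filter.2 ⟨Finset.mem_univ _, hx.2⟩, rfl⟩
  let f : C × {b : J → F // hammingNorm b = e} → (J → F) := fun cb => φ cb.1 + cb.2
  have hf : Function.Injective f := by
    rintro ⟨c, b, hb⟩ ⟨c', b', hb'⟩ h
    have h' : φ c + b = φ c' + b' := h
    have hcc : c = c' := by
      by_contra hne
      have h2 := hφ (c - c') (sub_ne_zero.2 hne)
      have h3 : φ (c - c') = b' - b := by
        rw [map_sub, sub_eq_sub_iff_add_eq_add, h', add_comm]
      rw [h3, sub_eq_neg_add, ← hammingDist_eq_hammingNorm] at h2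
      have h4 := hammingDist_triangle b 0 b'
      rw [hammingDist_zero_right, hammingDist_zero_left, hb, hb'] at h4
      omega
    subst hcc
    simpa using h'
  have h5 := Fintype.card_le_of_injective f hf
  rw [Fintype.card_prod, ← Nat.card_eq_fintype_card (α := C),
    Module.natCard_eq_pow_finrank (K := F), Nat.card_eq_fintype_card, Fintype.card_subtype,
    Fintype.card_fun, Fintype.card_coe] at h5
  exact (Nat.mul_le_mul_left _ h1).trans h5

/-- `(m / e) ^ e ≤ m.choose e`, cleared of denominators. -/
theorem pow_le_choose_mul_pow {m e : ℕ} (h : e ≤ m) : m ^ e ≤ m.choose e * e ^ e := by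
  induction e generalizing m with
  | zero => simp
  | succ e ih =>
    obtain ⟨m, rfl⟩ : ∃ m', m = m' + 1 := ⟨m - 1, by omega⟩
    have hem : e ≤ m := by omega
    have h1 : (m + 1) ^ e ≤ m.choose e * (e + 1) ^ e := by
      have hpos : 0 < e ^ e := Nat.pow_self_pos
      refine Nat.le_of_mul_le_mul_right ?_ hpos
      calc (m + 1) ^ e * e ^ e = ((m + 1) * e) ^ e := (mul_pow _ _ _).symm
        _ ≤ (m * (e + 1)) ^ e := Nat.pow_le_pow_left (by nlinarith) e
        _ = m ^ e * (e + 1) ^ e := mul_pow _ _ _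
        _ ≤ (m.choose e * e ^ e) * (e + 1) ^ e := Nat.mul_le_mul_right _ (ih hem)
        _ = m.choose e * (e + 1) ^ e * e ^ e := by ring
    calc (m + 1) ^ (e + 1) = (m + 1) * (m + 1) ^ e := pow_succ' _ _
      _ ≤ (m + 1) * (m.choose e * (e + 1) ^ e) := Nat.mul_le_mul_left _ h1
      _ = ((m + 1) * m.choose e) * (e + 1) ^ e := by ring
      _ = ((m + 1).choose (e + 1) * (e + 1)) * (e + 1) ^ e := by
        rw [Nat.add_one_mul_choose_eq]
      _ = (m + 1).choose (e + 1) * (e + 1) ^ (e + 1) := by ring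

/-- An optimal code with locality `r` and length `ℓ * (r + 1)`, for `T = ⌈k / r⌉` large compared with
`s = r * T - k`, has `ℓ` dual words with pairwise disjoint nonempty supports. -/
theorem exists_disjoint_repair_groups {F : Type*} [Field F] [DecidableEq F] {n r d ℓ T s : ℕ}
    (C : Submodule F (Fin n → F)) (hd : ∀ c ∈ C, c ≠ 0 → d ≤ hammingNorm c) (hd2 : 2 ≤ d)
    (hloc : HasLocality C r) (hn : n = ℓ * (r + 1)) (hs : s ≤ r)
    (hk : Module.finrank F C + s = r * T) (hopt : n + 2 = d + Module.finrank F C + T)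
    (hsT : 2 * (s + 1) ≤ T) (hTℓ : T ≤ ℓ) :
    ∃ (v : Fin n → Fin n → F) (A : Finset (Fin n)) (p : Fin n → Fin n),
      (∀ i, v i ∈ dualCode C) ∧ A.card = ℓ ∧ (∀ i ∈ A, v i (p i) ≠ 0) ∧
      ∀ i ∈ A, ∀ j ∈ A, i ≠ j → ∀ x, v i x ≠ 0 → v j x = 0 := by
  choose v hv hvi hvr using hloc
  let S : Fin n → Finset (Fin n) := fun i => Finset.univ.filter fun x => v i x ≠ 0
  have memS : ∀ i x, x ∈ S i ↔ v i x ≠ 0 := by simp [S]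
  have hS : ∀ i, (S i).card ≤ r + 1 := hvr
  obtain ⟨A, -, hA⟩ := exists_minimal_le_of_wellFoundedLT
    (fun A : Finset (Fin n) => A.biUnion S = Finset.univ) Finset.univ (by
      ext x
      simp only [Finset.mem_biUnion, Finset.mem_univ, true_and, iff_true]
      exact ⟨x, (memS x x).2 (hvi x)⟩)
  have hcov : ∀ x, ∃ i ∈ A, v i x ≠ 0 := by
    intro x
    have h : x ∈ A.biUnion S := by rw [hA.prop]; exact Finset.mem_univ x
    obtain ⟨i, hi, hx⟩ := Finset.mem_biUnion.1 h
    exact ⟨i, hi, (memS i x).1 hx⟩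
  have hprivate : ∀ i, ∃ x, i ∈ A → v i x ≠ 0 ∧ ∀ j ∈ A, i ≠ j → v j x = 0 := by
    intro i
    by_contra! hcon
    have hiA : i ∈ A := (hcon i).1
    have hall : (A.erase i).biUnion S = Finset.univ := by
      ext x
      simp only [Finset.mem_biUnion, Finset.mem_univ, iff_true]
      by_cases hx : v i x = 0
      · obtain ⟨j, hj, hjx⟩ := hcov x
        refine ⟨j, Finset.mem_erase.2 ⟨?_, hj⟩, (memS j x).2 hjx⟩
        rintro rfl
        exact hjx hx
      · obtain ⟨j, hj, hij, hjx⟩ := (hcon x).2 hx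
        exact ⟨j, Finset.mem_erase.2 ⟨hij.symm, hj⟩, (memS j x).2 hjx⟩
    have h := hA.le_of_le hall (Finset.erase_subset i A)
    exact Finset.notMem_erase i A (h hiA)
  choose p hp using hprivate
  have hAcov : (A.biUnion S).card = ℓ * (r + 1) := by
    have h := hA.prop
    rw [h, Finset.card_univ, Fintype.card_fin]
    exact hn
  have hℓA : ℓ ≤ A.card := by
    have h := Finset.card_biUnion_le_card_mul A S (r + 1) fun i _ => hS i
    rw [hAcov] at h
    exact Nat.le_of_mul_le_mul_right h r.succ_pos
  have hexact : A.card = ℓ := by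
    by_contra hne
    have hlt : ℓ < A.card := lt_of_le_of_ne hℓA (Ne.symm hne)
    have hdef : s + 1 + (A.biUnion S).card ≤ (r + 1) * A.card := by
      rw [hAcov]
      nlinarith
    obtain ⟨W, hWA, hWc, hW⟩ := exists_small_subfamily S (r + 1) hS A (s + 1) hdef
    obtain ⟨W', hWW', hW'A, hW'T⟩ := Finset.exists_subsuperset_card_eq hWA
      (hWc.trans hsT) (hTℓ.trans hℓA)
    have hW' : s + 1 + (W'.biUnion S).card ≤ (r + 1) * T := by
      have h1 : W'.biUnion S = W.biUnion S ∪ (W' \ W).biUnion S := by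
        rw [← Finset.union_biUnion, Finset.union_sdiff_of_subset hWW']
      have h2 := Finset.card_union_le (W.biUnion S) ((W' \ W).biUnion S)
      have h3 := Finset.card_biUnion_le_card_mul (W' \ W) S (r + 1) fun i _ => hS i
      have h4 := Finset.card_sdiff_add_card_eq_card hWW'
      rw [h1, ← hW'T]
      nlinarith
    have hUT : (W'.biUnion S).card ≤ Module.finrank F C + T - 1 := by
      have h : (r + 1) * T = r * T + T := by ring
      omega
    obtain ⟨U, hU, hUc⟩ := Finset.exists_superset_card_eq hUT
      (by rw [Fintype.card_fin]; omega)
    have h := finrank_add_card_le C hd v hv W' p (fun i hi => (hp i (hW'A hi)).1)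
      (fun i hi j hj hij => (hp i (hW'A hi)).2 j (hW'A hj) hij) U
      (fun i hi x hx => hU (Finset.mem_biUnion.2 ⟨i, hi, (memS i x).2 hx⟩)) (by omega)
    omega
  refine ⟨v, A, p, hv, hexact, fun i hi => (hp i hi).1, ?_⟩
  intro i hi j hj hij x hix
  by_contra hjx
  have hj' : j ∈ A.erase i := Finset.mem_erase.2 ⟨hij.symm, hj⟩
  have h1 : A.biUnion S = (S i ∪ S j) ∪ ((A.erase i).erase j).biUnion S := by
    rw [Finset.union_assoc, ← Finset.biUnion_insert, Finset.insert_erase hj',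
      ← Finset.biUnion_insert, Finset.insert_erase hi]
  have h2 := Finset.card_union_le (S i ∪ S j) (((A.erase i).erase j).biUnion S)
  have h3 := Finset.card_biUnion_le_card_mul ((A.erase i).erase j) S (r + 1) fun i _ => hS i
  have h4 := Finset.card_union_add_card_inter (S i) (S j)
  have h5 : 0 < (S i ∩ S j).card :=
    Finset.card_pos.2 ⟨x, Finset.mem_inter.2 ⟨(memS i x).2 hix, (memS j x).2 hjx⟩⟩
  have h6 := Finset.card_erase_add_one hi
  have h7 := Finset.card_erase_add_one hj'
  have h8 := hS i
  have h9 := hS j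
  rw [← h1, hAcov, ← hexact, ← h6, ← h7] at h2
  nlinarith

/-- Deleting one coordinate from each of a family of disjoint parity checks keeps at least half of
the weight of a codeword. -/
theorem hammingNorm_le_two_mul_card {F : Type*} [Field F] [DecidableEq F] {n : ℕ}
    (C : Submodule F (Fin n → F)) (v : Fin n → Fin n → F) (A : Finset (Fin n))
    (p : Fin n → Fin n) (hv : ∀ i, v i ∈ dualCode C) (hp : ∀ i ∈ A, v i (p i) ≠ 0)
    (hdisj : ∀ i ∈ A, ∀ j ∈ A, i ≠ j → ∀ x, v i x ≠ 0 → v j x = 0)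
    {c : Fin n → F} (hc : c ∈ C) :
    hammingNorm c ≤ 2 * ((Finset.univ \ A.image p).filter fun x => c x ≠ 0).card := by
  have hpart : ∀ i, ∃ x, i ∈ A → c (p i) ≠ 0 → v i x ≠ 0 ∧ c x ≠ 0 ∧ x ≠ p i := by
    intro i
    by_contra! hcon
    obtain ⟨hi, hci, -⟩ := hcon i
    have hsum := hv i c hc
    rw [Finset.sum_eq_single (p i)] at hsum
    · exact (mul_ne_zero (hp i hi) hci) hsum
    · intro y _ hy
      by_contra hne
      exact hy ((hcon y).2.2 (left_ne_zero_of_mul hne) (right_ne_zero_of_mul hne))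
    · simp
  choose u hu using hpart
  have hle : ((A.image p).filter fun x => c x ≠ 0).card ≤
      ((Finset.univ \ A.image p).filter fun x => c x ≠ 0).card := by
    have himage : ((A.image p).filter fun x => c x ≠ 0) ⊆
        (A.filter fun i => c (p i) ≠ 0).image p := by
      intro x hx
      obtain ⟨hx1, hx2⟩ := Finset.mem_filter.1 hx
      obtain ⟨i, hi, rfl⟩ := Finset.mem_image.1 hx1
      exact Finset.mem_image_of_mem p (Finset.mem_filter.2 ⟨hi, hx2⟩)
    refine ((Finset.card_le_card himage).trans Finset.card_image_le).trans ?_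
    refine Finset.card_le_card_of_injOn u ?_ ?_
    · intro i hi
      obtain ⟨hi, hci⟩ := Finset.mem_filter.1 hi
      obtain ⟨h1, h2, h3⟩ := hu i hi hci
      refine Finset.mem_filter.2 ⟨Finset.mem_sdiff.2 ⟨Finset.mem_univ _, fun h => ?_⟩, h2⟩
      obtain ⟨j, hj, hju⟩ := Finset.mem_image.1 h
      by_cases hij : i = j
      · exact h3 (by rw [← hju, hij])
      · exact hp j hj (by rw [hju]; exact hdisj i hi j hj hij _ h1)
    · intro i hi j hj hij
      obtain ⟨hi, hci⟩ := Finset.mem_filter.1 hi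
      obtain ⟨hj, hcj⟩ := Finset.mem_filter.1 hj
      by_contra hne
      exact (hu j hj hcj).1 (by rw [← hij]; exact hdisj i hi j hj hne _ (hu i hi hci).1)
  have hsplit : hammingNorm c ≤ ((A.image p).filter fun x => c x ≠ 0).card +
      ((Finset.univ \ A.image p).filter fun x => c x ≠ 0).card := by
    refine le_trans (Finset.card_le_card ?_) (Finset.card_union_le _ _)
    rw [← Finset.filter_union, Finset.union_sdiff_of_subset (Finset.subset_univ _)]
  omega

/-- The sphere-packing inequality solved for the length. -/
theorem le_div_mul_rpow_of_choose_mul_le {q m e t : ℕ} {D : ℝ} (hq : 2 ≤ q) (he : 0 < e)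
    (htD : (t : ℝ) ≤ D) (heD : (e : ℝ) ≤ D) (h : m.choose e * (q - 1) ^ e ≤ q ^ t) :
    (m : ℝ) ≤ (e : ℝ) / ((q : ℝ) - 1) * (q : ℝ) ^ (D / e) := by
  have hq2 : (2 : ℝ) ≤ q := by exact_mod_cast hq
  have he0 : (0 : ℝ) < e := by exact_mod_cast he
  have hq1 : (0 : ℝ) < (q : ℝ) - 1 := by linarith
  rw [div_mul_eq_mul_div, le_div_iff₀ hq1]
  rcases lt_or_ge m e with hme | hem
  · have h1 : (q : ℝ) ^ (1 : ℝ) ≤ (q : ℝ) ^ (D / e) :=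
      Real.rpow_le_rpow_of_exponent_le (by linarith) (by rwa [le_div_iff₀ he0, one_mul])
    rw [Real.rpow_one] at h1
    have h2 : (m : ℝ) ≤ e := by exact_mod_cast hme.le
    exact mul_le_mul h2 (by linarith) hq1.le he0.le
  · have h1 : m ^ e * (q - 1) ^ e ≤ e ^ e * q ^ t := by
      calc m ^ e * (q - 1) ^ e ≤ (m.choose e * e ^ e) * (q - 1) ^ e :=
            Nat.mul_le_mul_right _ (pow_le_choose_mul_pow hem)
        _ = e ^ e * (m.choose e * (q - 1) ^ e) := by ring
        _ ≤ e ^ e * q ^ t := Nat.mul_le_mul_left _ h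
    have h2 : (m : ℝ) ^ e * ((q : ℝ) - 1) ^ e ≤ (e : ℝ) ^ e * (q : ℝ) ^ t := by
      have h3 : ((m ^ e * (q - 1) ^ e : ℕ) : ℝ) ≤ ((e ^ e * q ^ t : ℕ) : ℝ) := by exact_mod_cast h1
      push_cast [Nat.cast_sub (by omega : 1 ≤ q)] at h3
      exact h3
    have h4 : (q : ℝ) ^ t ≤ ((q : ℝ) ^ (D / e)) ^ e := by
      rw [← Real.rpow_natCast, ← Real.rpow_natCast, ← Real.rpow_mul (by linarith),
        div_mul_cancel₀ _ he0.ne']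
      exact Real.rpow_le_rpow_of_exponent_le (by linarith) htD
    refine le_of_pow_le_pow_left₀ he.ne' (by positivity) ?_
    rw [mul_pow, mul_pow]
    exact h2.trans (mul_le_mul_of_nonneg_left h4 (by positivity))

/-- Upper bound on the length of an optimal LRC when `d ≡ a (mod 4)` with `a ∈ {3,4}`:
`n ≤ ((r+1)/r) · (((d-a)/(4(q-1))) · q^{4(d-3)/(d-a)} + 1)`. -/
theorem stmt_5 {F : Type*} [Field F] [Fintype F] [DecidableEq F] {n r k d a : ℕ}
    (C : Submodule F (Fin n → F)) (hr : 0 < r)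
    (hk : k = Module.finrank F ↥C) (hk1 : 1 ≤ k) (hd5 : 5 ≤ d)
    (hmd : IsMinDist C d) (hloc : HasLocality C r)
    (hopt : (d : ℤ) = (n : ℤ) - k - ⌈(k : ℚ) / (r : ℚ)⌉ + 2)
    (hdvd : (r + 1) ∣ n)
    (hbig : ((n / (r + 1) : ℕ) : ℤ) ≥
      ((d : ℤ) - 2 - ⌊((d : ℚ) - 2) / ((r : ℚ) + 1)⌋) * (3 * r + 2) +
        ⌊((d : ℚ) - 2) / ((r : ℚ) + 1)⌋ + 1)
    (ha : a = 3 ∨ a = 4) (hmod : d % 4 = a % 4) :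
    (n : ℝ) ≤ ((r : ℝ) + 1) / (r : ℝ) *
      ((((d : ℝ) - (a : ℝ)) / (4 * ((Fintype.card F : ℝ) - 1))) *
        (Fintype.card F : ℝ) ^ (4 * ((d : ℝ) - 3) / ((d : ℝ) - (a : ℝ))) + 1) := by
  obtain ⟨ℓ, hℓ⟩ := hdvd
  have hnℓ : n = ℓ * (r + 1) := by rw [hℓ, mul_comm]
  have hdiv : n / (r + 1) = ℓ := by rw [hℓ, Nat.mul_div_cancel_left _ r.succ_pos]
  rw [hdiv] at hbig
  have hrQ : (0 : ℚ) < r := by exact_mod_cast hr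
  set T := ⌈(k : ℚ) / (r : ℚ)⌉₊ with hT
  have hTZ : ⌈(k : ℚ) / (r : ℚ)⌉ = (T : ℤ) :=
    (Int.natCast_ceil_eq_ceil (by positivity)).symm
  have hkT : k ≤ r * T := by
    have h := Nat.le_ceil ((k : ℚ) / (r : ℚ))
    rw [← hT, div_le_iff₀ hrQ, mul_comm] at h
    exact_mod_cast h
  have hTk : r * T < k + r := by
    have h := Nat.ceil_lt_add_one (a := (k : ℚ) / (r : ℚ)) (by positivity)
    rw [← hT, div_add_one hrQ.ne', lt_div_iff₀ hrQ, mul_comm] at h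
    exact_mod_cast h
  obtain ⟨s, hs⟩ : ∃ s, k + s = r * T := ⟨r * T - k, by omega⟩
  have hsr : s < r := by omega
  have hopt' : n + 2 = d + k + T := by rw [hTZ] at hopt; omega
  have hfloor : ⌊((d : ℚ) - 2) / ((r : ℚ) + 1)⌋ = (ℓ : ℤ) - T := by
    have h1 : (ℓ : ℚ) * (r + 1) + 2 = d + k + T := by rw [hnℓ] at hopt'; exact_mod_cast hopt'
    have h2 : (k : ℚ) + s = r * T := by exact_mod_cast hs
    have h3 : (s : ℚ) < r := by exact_mod_cast hsr
    have h4 : (0 : ℚ) ≤ s := Nat.cast_nonneg s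
    have hr1 : (0 : ℚ) < (r : ℚ) + 1 := by linarith
    rw [Int.floor_eq_iff, le_div_iff₀ hr1, div_lt_iff₀ hr1]
    push_cast
    constructor <;> nlinarith
  rw [hfloor] at hbig
  have hnZ : (ℓ : ℤ) * (r + 1) + 2 = d + k + T := by rw [hnℓ] at hopt'; exact_mod_cast hopt'
  have hsZ : (k : ℤ) + s = r * T := by exact_mod_cast hs
  have hTℓ : T ≤ ℓ := by
    by_contra! hlt
    have h1 : (ℓ : ℤ) + 1 ≤ T := by exact_mod_cast hlt
    have h2 : (5 : ℤ) ≤ d := by exact_mod_cast hd5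
    have h3 : (s : ℤ) < r := by exact_mod_cast hsr
    nlinarith
  have hsT : 2 * (s + 1) ≤ T := by
    obtain ⟨f, rfl⟩ := Nat.exists_eq_add_of_le hTℓ
    push_cast at hbig hnZ
    have h1 : (d : ℤ) - 2 - (T + f - T) = s + r * f := by linarith
    have h2 : (5 : ℤ) ≤ d := by exact_mod_cast hd5
    have h3 : (1 : ℤ) ≤ r := by exact_mod_cast hr
    have h4 : (s : ℤ) ≤ s + r * f := by nlinarith [Int.natCast_nonneg f]
    have h5 : (1 : ℤ) ≤ s + r * f := by
      by_contra! hlt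
      have h6 : (f : ℤ) ≤ r * f := by nlinarith [Int.natCast_nonneg f]
      have h7 := Int.natCast_nonneg s
      linarith
    rw [h1] at hbig
    have h8 : (T : ℤ) ≥ (s + r * f) * (3 * r + 2) + 1 := by linarith
    have h9 : (s + r * f : ℤ) * 5 ≤ (s + r * f) * (3 * r + 2) :=
      mul_le_mul_of_nonneg_left (by linarith) (by linarith)
    have h10 : (2 * (s + 1) : ℤ) ≤ T := by linarith
    exact_mod_cast h10
  have hd : ∀ c ∈ C, c ≠ 0 → d ≤ hammingNorm c := fun c hc h0 => hmd.2 ⟨c, hc, h0, rfl⟩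
  obtain ⟨v, A, p, hv, hAℓ, hp, hdisj⟩ := exists_disjoint_repair_groups C hd (by omega) hloc
    hnℓ hsr.le (by rw [← hk]; exact hs) (by rw [← hk]; exact hopt') hsT hTℓ
  obtain ⟨e, he, hde⟩ : ∃ e, 0 < e ∧ d = 4 * e + a := ⟨(d - a) / 4, by omega, by omega⟩
  have hweight : ∀ c ∈ C, c ≠ 0 →
      2 * e + 1 < ((Finset.univ \ A.image p).filter fun x => c x ≠ 0).card := by
    intro c hc h0
    have h1 := hammingNorm_le_two_mul_card C v A p hv hp hdisj hc
    have h2 := hd c hc h0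
    omega
  have hinj : Set.InjOn p A := by
    intro i hi j hj hij
    by_contra hne
    exact hp j hj (by rw [← hij]; exact hdisj i hi j hj hne _ (hp i hi))
  have hcard : (Finset.univ \ A.image p).card = r * ℓ := by
    have h := Finset.card_sdiff_add_card_eq_card (Finset.subset_univ (A.image p))
    rw [Finset.card_image_of_injOn hinj, hAℓ, Finset.card_univ, Fintype.card_fin] at h
    have h' : n = r * ℓ + ℓ := by rw [hnℓ]; ring
    omega
  have hrℓ : 0 < r * ℓ := Nat.mul_pos hr (by omega)
  obtain ⟨x₀, hx₀⟩ := Finset.card_pos.1 (hcard.symm ▸ hrℓ)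
  have hpack := pow_finrank_mul_choose_le (e := e) C ((Finset.univ \ A.image p).erase x₀) (by
    intro c hc h0
    have h1 := hweight c hc h0
    rw [Finset.filter_erase]
    have h2 := Finset.pred_card_le_card_erase
      (s := (Finset.univ \ A.image p).filter fun x => c x ≠ 0) (a := x₀)
    omega)
  rw [Finset.card_erase_of_mem hx₀, hcard, ← hk] at hpack
  have hq : 2 ≤ Fintype.card F := Fintype.one_lt_card
  have hkℓ : k + 1 ≤ r * ℓ := by
    by_contra! hlt
    have h1 : ℓ ≤ T := Nat.le_of_mul_le_mul_left (by omega : r * ℓ ≤ r * T) hr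
    have h2 : n = r * ℓ + ℓ := by rw [hnℓ]; ring
    omega
  have hsphere : (r * ℓ - 1).choose e * (Fintype.card F - 1) ^ e ≤
      Fintype.card F ^ (r * ℓ - 1 - k) := by
    refine Nat.le_of_mul_le_mul_left ?_ (pow_pos (by omega : 0 < Fintype.card F) k)
    rwa [← pow_add, Nat.add_sub_cancel' (by omega)]
  have hexp : r * ℓ - 1 - k ≤ d - 3 := by
    have h : n = r * ℓ + ℓ := by rw [hnℓ]; ring
    omega
  have hd3 : ((d - 3 : ℕ) : ℝ) = (d : ℝ) - 3 := by
    rw [Nat.cast_sub (by omega)]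
    norm_num
  have hmain := le_div_mul_rpow_of_choose_mul_le (D := (d : ℝ) - 3) hq he
    (by rw [← hd3]; exact_mod_cast hexp)
    (by rw [← hd3]; exact_mod_cast (by omega : e ≤ d - 3)) hsphere
  rw [Nat.cast_sub hrℓ] at hmain
  push_cast at hmain
  have hda : (d : ℝ) - a = 4 * e := by rw [hde]; push_cast; ring
  rw [hda, mul_div_mul_left _ _ four_ne_zero, mul_div_mul_left _ _ four_ne_zero]
  have hrR : (0 : ℝ) < r := by exact_mod_cast hr
  have hnR : (n : ℝ) = ((r : ℝ) + 1) / r * (r * ℓ) := by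
    rw [hnℓ]
    push_cast
    field_simp
  rw [hnR]
  exact mul_le_mul_of_nonneg_left (by linarith) (by positivity)
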